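/- arXiv:2210.01105 — 5 statements merged into one kernel-verified Lean document; each statement's English description precedes it below -/
import Mathlib

section
/- Let $k \ge 2$ be an integer and let $F$ be a $(k+2,k)$-free $3$-uniform hypergraph. Then there exists a $(k+2,k)$-free subhypergraph $F'$ of $F$ that is also $(\ell+1,\ell)$-free for all $\ell \in [2,k-1]$, such that $e(F) - e(F') \le \frac{1}{6}(1 - \frac{1}{k})(v(F) - v(F'))(v(F) + v(F') + 2k)$. -/
open Finset

lemma aux_comp {V : Type*} [DecidableEq V] (k l : ℕ) (S : Finset V) (hlk : l + 1 ≤ k)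
    (X : Finset (Finset V))
    (hX : ∀ e ∈ X, (e \ S).card ≤ 2)
    (hA : ∀ Y ⊆ X, l + Y.card = k → Y.card + 1 < ((Y.sup id) \ S).card)
    (hB : ∀ Y ⊆ X, Y.Nonempty → l + Y.card + 1 ≤ k → Y.card < ((Y.sup id) \ S).card) :
    k * X.card ≤ (k - 1) * ((X.sup id) \ S).card := by
  induction X using Finset.strongInduction with
  | H X ih =>
  rcases X.eq_empty_or_nonempty with rfl | ⟨e0, he0⟩
  · simp
  let C := X.powerset.filter (fun Y => Y.Nonempty ∧ l + Y.card ≤ k ∧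
    ((Y.sup id) \ S).card ≤ Y.card + 1)
  have hC : C.Nonempty := by
    refine ⟨{e0}, ?_⟩
    simp only [C, mem_filter, mem_powerset, singleton_subset_iff, card_singleton, sup_singleton, id]
    exact ⟨he0, singleton_nonempty _, hlk, hX e0 he0⟩
  obtain ⟨Y, hYC, hmax⟩ := C.exists_max_image Finset.card hC
  simp only [C, mem_filter, mem_powerset] at hYC hmax
  obtain ⟨hYX, hYne, hYk, hYv⟩ := hYC
  have hlt : l + Y.card + 1 ≤ k := by
    rcases Nat.lt_or_ge (l + Y.card) k with h | h
    · exact h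
    · have := hA Y hYX (by omega)
      omega
  have hYv2 := hB Y hYX hYne hlt
  have hdis : ∀ e ∈ X \ Y, Disjoint (e \ S) ((Y.sup id) \ S) := by
    intro e he
    rw [mem_sdiff] at he
    by_contra hd
    rw [not_disjoint_iff_nonempty_inter, ← card_pos] at hd
    have h1 : (((insert e Y).sup id) \ S) = (e \ S) ∪ ((Y.sup id) \ S) := by
      rw [sup_insert]
      exact union_sdiff_distrib _ _ _
    have h2 := card_union_add_card_inter (e \ S) ((Y.sup id) \ S)
    have h3 := hX e he.1
    have h4 := card_insert_of_notMem he.2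
    have := hmax (insert e Y) ⟨insert_subset he.1 hYX, insert_nonempty _ _, by omega, by
      rw [h1]; omega⟩
    omega
  have hsub : X \ Y ⊂ X := sdiff_ssubset hYX hYne
  have hi := ih (X \ Y) hsub (fun e he => hX e (hsub.1 he))
    (fun Z hZ => hA Z (hZ.trans hsub.1)) (fun Z hZ => hB Z (hZ.trans hsub.1))
  have hXu : X.sup id \ S = ((X \ Y).sup id \ S) ∪ (Y.sup id \ S) := by
    conv_lhs => rw [← sdiff_union_of_subset hYX, sup_union]
    exact union_sdiff_distrib _ _ _
  have hd2 : Disjoint ((X \ Y).sup id \ S) (Y.sup id \ S) := by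
    rw [Finset.disjoint_left]
    intro a ha
    rw [mem_sdiff, Finset.mem_sup] at ha
    obtain ⟨⟨e, he, hae⟩, haS⟩ := ha
    exact Finset.disjoint_left.1 (hdis e he) (mem_sdiff.2 ⟨hae, haS⟩)
  rw [hXu, card_union_of_disjoint hd2, ← card_sdiff_add_card_eq_card hYX, mul_add, mul_add]
  have : k * Y.card ≤ (k - 1) * (Y.sup id \ S).card := by
    have e1 : (Y.sup id \ S).card = Y.card + 1 := by omega
    rw [e1]
    obtain ⟨j, rfl⟩ : ∃ j, k = j + 1 := ⟨k - 1, by omega⟩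
    simp only [Nat.add_sub_cancel]
    nlinarith
  omega

lemma aux_step {V : Type*} [DecidableEq V]
    (k : ℕ) (F : Finset (Finset V)) (U : Finset V) (h3 : ∀ e ∈ F, e.card = 3)
    (hU : ∀ e ∈ F, e ⊆ U)
    (hfree : ∀ T ⊆ F, T.card = k → k + 2 < (T.sup id).card)
    (hbad : ∃ T ⊆ F, 2 ≤ T.card ∧ T.card + 1 ≤ k ∧ (T.sup id).card ≤ T.card + 1) :
    ∃ S ⊆ U, 3 ≤ S.card ∧
      k * (F.filter (fun e => ¬ Disjoint e S)).card ≤ k * (k - 1) + (k - 1) * (U \ S).card := by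
  let C := F.powerset.filter (fun T => 2 ≤ T.card ∧ T.card + 1 ≤ k ∧ (T.sup id).card ≤ T.card + 1)
  have hC : C.Nonempty := by
    obtain ⟨T, h, h'⟩ := hbad
    exact ⟨T, by simp only [C, mem_filter, mem_powerset]; exact ⟨h, h'⟩⟩
  obtain ⟨T, hTC, hmax⟩ := C.exists_max_image Finset.card hC
  simp only [C, mem_filter, mem_powerset] at hTC hmax
  obtain ⟨hTF, hT2, hTk, hTv⟩ := hTC
  set S := T.sup id with hS
  have hsupU : ∀ Z ⊆ F, Z.sup id ⊆ U := fun Z hZ => Finset.sup_le (fun e he => hU e (hZ he))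
  refine ⟨S, hsupU T hTF, ?_, ?_⟩
  · obtain ⟨e, he⟩ : T.Nonempty := card_pos.1 (by omega)
    rw [← h3 e (hTF he)]
    exact card_le_card (Finset.le_sup (f := id) he)
  set X := (F.filter (fun e => ¬ Disjoint e S)) \ T with hXdef
  have hXF : X ⊆ F := fun e he => (mem_filter.1 (mem_sdiff.1 he).1).1
  have hcard : ∀ Y ⊆ X, (T ∪ Y).card = T.card + Y.card := fun Y hY =>
    card_union_of_disjoint (disjoint_sdiff.mono_right hY)
  have hsup : ∀ Y : Finset (Finset V), ((T ∪ Y).sup id).card = S.card + (Y.sup id \ S).card := by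
    intro Y
    rw [sup_union, ← hS]
    have : S ⊔ Y.sup id = S ∪ (Y.sup id \ S) := by simp
    rw [this, card_union_of_disjoint disjoint_sdiff]
  have key := aux_comp k T.card S hTk X (by
      intro e he
      have h1 := (mem_filter.1 (mem_sdiff.1 he).1).2
      rw [not_disjoint_iff_nonempty_inter, ← card_pos] at h1
      have h2 := card_sdiff_add_card_inter e S
      have := h3 e (hXF he)
      omega) (by
      intro Y hY hc
      have := hfree (T ∪ Y) (union_subset hTF (hY.trans hXF)) (by rw [hcard Y hY, hc])
      rw [hsup] at this
      omega) (by
      intro Y hY hne hc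
      by_contra hcon
      have h1 := hcard Y hY
      have h2 := hsup Y
      have h4 := card_pos.2 hne
      have := hmax (T ∪ Y) ⟨union_subset hTF (hY.trans hXF), by omega, by omega, by omega⟩
      omega)
  have h1 : (F.filter (fun e => ¬ Disjoint e S)).card ≤ (k - 1) + X.card := by
    have := card_le_card_sdiff_add_card (t := T) (s := F.filter (fun e => ¬ Disjoint e S))
    rw [← hXdef] at this
    omega
  have h2 : (X.sup id \ S).card ≤ (U \ S).card :=
    card_le_card (sdiff_subset_sdiff (hsupU X hXF) le_rfl)
  calc _ ≤ k * ((k - 1) + X.card) := Nat.mul_le_mul_left _ h1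
    _ = k * (k - 1) + k * X.card := mul_add _ _ _
    _ ≤ _ := Nat.add_le_add_left (key.trans (Nat.mul_le_mul_left _ h2)) _

lemma aux_main {V : Type*} [DecidableEq V]
    (k : ℕ) (hk : 2 ≤ k) (U : Finset V) : ∀ (F : Finset (Finset V)) (_ : ∀ e ∈ F, e.card = 3)
    (_ : ∀ e ∈ F, e ⊆ U)
    (_ : ∀ T ⊆ F, T.card = k → k + 2 < (T.sup id).card),
    ∃ U' ⊆ U, (∀ ℓ, 2 ≤ ℓ → ℓ ≤ k - 1 → ∀ T ⊆ F.filter (fun e => e ⊆ U'),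
        T.card = ℓ → ℓ + 1 < (T.sup id).card) ∧
      (F.card : ℝ) - (F.filter (fun e => e ⊆ U')).card ≤
        1 / 6 * (1 - 1 / (k : ℝ)) * ((U.card : ℝ) - U'.card) *
          ((U.card : ℝ) + U'.card + 2 * k) := by
  induction U using Finset.strongInduction with
  | H U ih =>
  intro F h3 hU hfree
  by_cases hbad : ∃ T ⊆ F, 2 ≤ T.card ∧ T.card + 1 ≤ k ∧ (T.sup id).card ≤ T.card + 1
  · obtain ⟨S, hSU, hS3, hS⟩ := aux_step k F U h3 hU hfree hbad
    have hss : U \ S ⊂ U := sdiff_ssubset hSU (card_pos.1 (by omega))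
    set G := F.filter (fun e => e ⊆ U \ S) with hG
    have hGF : G ⊆ F := filter_subset _ _
    obtain ⟨U', hU', hfr, hle⟩ := ih (U \ S) hss G (fun e he => h3 e (hGF he))
      (fun e he => (mem_filter.1 he).2) (fun T hT => hfree T (hT.trans hGF))
    have hGG : G.filter (fun e => e ⊆ U') = F.filter (fun e => e ⊆ U') := by
      ext e
      simp only [hG, mem_filter]
      exact ⟨fun h => ⟨h.1.1, h.2⟩, fun h => ⟨⟨h.1, h.2.trans hU'⟩, h.2⟩⟩
    rw [hGG] at hfr hle
    refine ⟨U', hU'.trans hss.1, hfr, ?_⟩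
    have hsplit : F.card = G.card + (F.filter (fun e => ¬ Disjoint e S)).card := by
      rw [← card_filter_add_card_filter_not (s := F) (fun e => Disjoint e S)]
      congr 2
      ext e
      simp only [hG, mem_filter]
      refine and_congr_right fun he => ?_
      rw [subset_sdiff]
      exact ⟨fun h => ⟨hU e he, h⟩, fun h => h.2⟩
    have hUc : U.card = (U \ S).card + S.card := (card_sdiff_add_card_eq_card hSU).symm
    generalize (F.filter (fun e => ¬ Disjoint e S)).card = x at *
    generalize (U \ S).card = w at *
    generalize S.card = s at *
    rw [hsplit, hUc]
    have hk0 : (0 : ℝ) < k := by positivity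
    have hS' : (k : ℝ) * x ≤ k * (k - 1) + (k - 1) * w := by
      have : ((k - 1 : ℕ) : ℝ) = (k : ℝ) - 1 := by
        rw [Nat.cast_sub (by omega)]; simp
      rw [← this]; exact_mod_cast hS
    have hx : (x : ℝ) ≤ (k - 1) + (1 - 1 / k) * w := by
      have : ((k : ℝ) - 1) + (1 - 1 / k) * w = (k * (k - 1) + (k - 1) * w) / k := by
        field_simp
      rw [this, le_div_iff₀ hk0]; linarith
    have hc : (1 - 1 / (k : ℝ)) * k = k - 1 := by field_simp
    have hc0 : 0 ≤ 1 - 1 / (k : ℝ) := by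
      have : (2 : ℝ) ≤ k := by exact_mod_cast hk
      rw [sub_nonneg, div_le_one hk0]; linarith
    have hs : (3 : ℝ) ≤ s := by exact_mod_cast hS3
    have hw : (0 : ℝ) ≤ w := by positivity
    push_cast
    generalize 1 - 1 / (k : ℝ) = c at *
    have hfin : c * k + c * w ≤ 1 / 6 * c * s * (2 * w + s + 2 * k) := by
      have h1 : 0 ≤ c * ((s - 3) * (w + k)) := by
        apply mul_nonneg hc0; apply mul_nonneg <;> linarith
      have h2 : 0 ≤ c * (s * s) := by positivity
      nlinarith
    nlinarith
  · push Not at hbad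
    have hF : F.filter (fun e => e ⊆ U) = F := filter_true_of_mem hU
    refine ⟨U, Subset.rfl, ?_, ?_⟩
    · rw [hF]
      intro l hl hlk T hT hTc
      have := hbad T hT (by omega) (by omega)
      omega
    · rw [hF]; simp

/-- Every `(k+2,k)`-free 3-uniform hypergraph `F` has an induced
subhypergraph `F'` (induced on a vertex subset `U`) that is `(k+2,k)`-free and
`(ℓ+1,ℓ)`-free for all `ℓ ∈ [2, k-1]`, losing at most
`(1/6)(1 - 1/k)(v(F) - v(F'))(v(F) + v(F') + 2k)` edges. -/
theorem exists_sparse_free_induced_subgraph {V : Type*} [Fintype V] [DecidableEq V]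
    (k : ℕ) (hk : 2 ≤ k) (F : Finset (Finset V)) (h3 : ∀ e ∈ F, e.card = 3)
    (hfree : ∀ T ⊆ F, T.card = k → k + 2 < (T.sup id).card) :
    ∃ U : Finset V, ∃ F' : Finset (Finset V), F' = F.filter (fun e => e ⊆ U) ∧
      (∀ T ⊆ F', T.card = k → k + 2 < (T.sup id).card) ∧
      (∀ ℓ, 2 ≤ ℓ → ℓ ≤ k - 1 → ∀ T ⊆ F', T.card = ℓ → ℓ + 1 < (T.sup id).card) ∧
      (F.card : ℝ) - F'.card ≤
        1 / 6 * (1 - 1 / (k : ℝ)) * ((Fintype.card V : ℝ) - U.card) *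
          ((Fintype.card V : ℝ) + U.card + 2 * k) := by
  obtain ⟨U, -, h1, h2⟩ := aux_main k hk Finset.univ F h3 (fun e _ => subset_univ e) hfree
  exact ⟨U, _, rfl, fun T hT => hfree T (hT.trans (filter_subset _ _)), h1, h2⟩
end

section
/- Let $k \ge 2$ be an integer and let $F$ be a $3$-uniform hypergraph that is $(k+2,k)$-free and also $(\ell+1,\ell)$-free for all $\ell \in [2,k-1]$. Let $H$ be the graph whose vertices are the edges of $F$, with two edges of $F$ adjacent in $H$ if they share at least $2$ vertices. Then every connected subgraph $T$ of $H$ satisfies $v(T) \le k-1$, and the union of the edges of $F$ forming $V(T)$ spans exactly $v(T) + 2$ vertices of $F$. -/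
open Finset

/-- Let `F` be a 3-uniform hypergraph that is `(k+2,k)`-free and
`(ℓ+1,ℓ)`-free for all `ℓ ∈ [2,k-1]`, and let `H` be the graph on the edges of `F`
joining two edges when they share at least 2 vertices. Every connected (induced)
subgraph `T` of `H` has at most `k - 1` vertices and spans exactly `|T| + 2`
vertices of `F`. -/
theorem connected_cluster_size_and_span {V : Type*} [DecidableEq V]
    (k : ℕ) (hk : 2 ≤ k) (F : Finset (Finset V)) (h3 : ∀ e ∈ F, e.card = 3)
    (hfreek : ∀ T ⊆ F, T.card = k → k + 2 < (T.sup id).card)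
    (hfreeℓ : ∀ ℓ, 2 ≤ ℓ → ℓ ≤ k - 1 → ∀ T ⊆ F, T.card = ℓ → ℓ + 1 < (T.sup id).card)
    (H : SimpleGraph {e // e ∈ F})
    (hH : ∀ e f : {e // e ∈ F}, H.Adj e f ↔ e ≠ f ∧ 2 ≤ ((e : Finset V) ∩ (f : Finset V)).card)
    (T : Finset {e // e ∈ F})
    (hTconn : (H.induce (↑T : Set {e // e ∈ F})).Connected) :
    T.card ≤ k - 1 ∧ (T.sup (fun e => (e : Finset V))).card = T.card + 2 := by
  have hgrow : ∀ m, 1 ≤ m → m ≤ T.card → ∃ S ⊆ T, S.card = m ∧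
      (S.sup (fun e => (e : Finset V))).card ≤ m + 2 := by
    intro m hm
    induction m, hm using Nat.le_induction with
    | base =>
      intro _
      obtain ⟨⟨u, hu⟩⟩ := hTconn.nonempty
      refine ⟨{u}, by simpa using hu, by simp, ?_⟩
      simp [h3 u.1 u.2]
    | succ m hm ih =>
      intro hmT
      obtain ⟨S, hST, hSc, hS⟩ := ih (by omega)
      obtain ⟨u, hu⟩ : S.Nonempty := by
        rw [← Finset.card_pos]; omega
      obtain ⟨v, hv, hvS⟩ : ∃ v ∈ T, v ∉ S := by
        by_contra! hcon
        have := Finset.card_le_card (show T ⊆ S from hcon)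
        omega
      obtain ⟨p⟩ := hTconn.preconnected ⟨u, hST hu⟩ ⟨v, hv⟩
      obtain ⟨d, -, hd1, hd2⟩ := p.exists_boundary_dart {x | x.1 ∈ S} hu hvS
      have hadj : H.Adj d.fst.1 d.snd.1 := d.adj
      obtain ⟨-, hint⟩ := (hH _ _).1 hadj
      have hd1' : d.fst.1 ∈ S := hd1
      have hd2' : d.snd.1 ∉ S := hd2
      have hd2T : d.snd.1 ∈ T := d.snd.2
      generalize d.fst.1 = e at *
      generalize d.snd.1 = f at *
      refine ⟨insert f S, ?_, ?_, ?_⟩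
      · exact Finset.insert_subset hd2T hST
      · rw [Finset.card_insert_of_notMem hd2', hSc]
      · rw [Finset.sup_insert]
        have hle : (e : Finset V) ⊆ S.sup (fun e => (e : Finset V)) :=
          Finset.le_sup (f := fun e : {e // e ∈ F} => (e : Finset V)) hd1'
        have h1 := Finset.card_union_add_card_inter (f : Finset V)
          (S.sup (fun e => (e : Finset V)))
        have h2 : ((e : Finset V) ∩ f).card ≤
            ((f : Finset V) ∩ S.sup (fun e => (e : Finset V))).card := by
          apply Finset.card_le_card
          rw [Finset.inter_comm]
          exact Finset.inter_subset_inter_left hle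
        have h4 := h3 f.1 f.2
        simp only [Finset.sup_eq_union]
        omega
  have hmap : ∀ S : Finset {e // e ∈ F},
      (S.map (Function.Embedding.subtype _)) ⊆ F ∧
      (S.map (Function.Embedding.subtype _)).card = S.card ∧
      (S.map (Function.Embedding.subtype _)).sup id = S.sup (fun e => (e : Finset V)) := by
    intro S
    refine ⟨?_, Finset.card_map _, ?_⟩
    · intro x hx
      obtain ⟨y, -, rfl⟩ := Finset.mem_map.1 hx
      exact y.2
    · rw [Finset.sup_map]; rfl
  have hTk : T.card ≤ k - 1 := by
    by_contra hcon
    obtain ⟨S, -, hSc, hS⟩ := hgrow k (by omega) (by omega)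
    obtain ⟨a, b, c⟩ := hmap S
    have := hfreek _ a (b.trans hSc)
    rw [c] at this
    omega
  refine ⟨hTk, ?_⟩
  obtain ⟨⟨u, hu⟩⟩ := hTconn.nonempty
  have hpos : 0 < T.card := Finset.card_pos.2 ⟨u, hu⟩
  obtain ⟨S, hST, hSc, hS⟩ := hgrow T.card hpos le_rfl
  obtain rfl := Finset.eq_of_subset_of_card_le hST hSc.ge
  apply le_antisymm hS
  obtain ⟨a, b, c⟩ := hmap S
  rcases Nat.lt_or_ge S.card 2 with h | h
  · have hle : (u : Finset V) ⊆ S.sup (fun e => (e : Finset V)) :=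
      Finset.le_sup (f := fun e : {e // e ∈ F} => (e : Finset V)) hu
    have := Finset.card_le_card hle
    have := h3 u.1 u.2
    omega
  · have := hfreeℓ _ h hTk _ a b
    rw [c] at this
    omega
end

section
/- Let $k \ge 2$ be an integer and let $F$ be a $3$-uniform hypergraph on $n$ vertices that is $(k+2,k)$-free and also $(\ell+1,\ell)$-free for all $\ell \in [2,k-1]$. Then $e(F) \le \frac{k-1}{2k-1}\binom{n}{2} \le \frac{k-1}{4k-2} n^2$. -/
open Finset

/-- The pairs covered by a family. -/
def shadow2 {V : Type*} [DecidableEq V] (T : Finset (Finset V)) : Finset (Finset V) :=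
  T.biUnion (powersetCard 2)

theorem ext_step {V : Type*} [DecidableEq V]
    (j : ℕ) (F : Finset (Finset V)) (h3 : ∀ e ∈ F, e.card = 3)
    (hfreek : ∀ T ⊆ F, T.card = j + 1 → j + 3 < (T.sup id).card)
    (hfreel : ∀ l, 2 ≤ l → l ≤ j → ∀ T ⊆ F, T.card = l → l + 1 < (T.sup id).card)
    (T : Finset (Finset V)) (hT : T ⊆ F) (h0 : 1 ≤ T.card) (hj : T.card ≤ j)
    (hs : (T.sup id).card ≤ T.card + 2) (hd : 2 * T.card + 1 ≤ (shadow2 T).card)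
    (e : Finset V) (he : e ∈ F) (heT : e ∉ T)
    (hnd : ¬ Disjoint (powersetCard 2 e) (shadow2 T)) :
    (insert e T).card ≤ j ∧ ((insert e T).sup id).card ≤ (insert e T).card + 2 ∧
      2 * (insert e T).card + 1 ≤ (shadow2 (insert e T)).card := by
  have hsub : insert e T ⊆ F := insert_subset he hT
  have hc : (insert e T).card = T.card + 1 := card_insert_of_notMem heT
  have hsup : (insert e T).sup id = e ∪ T.sup id := by
    rw [sup_insert]; rfl
  obtain ⟨p, hp1, hp2⟩ := not_disjoint_iff.1 hnd
  have h3e := h3 e he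
  have hpint : p ⊆ e ∩ T.sup id := by
    rw [mem_powersetCard] at hp1
    obtain ⟨f, hf, hpf⟩ := mem_biUnion.1 hp2
    rw [mem_powersetCard] at hpf
    exact subset_inter hp1.1 (hpf.1.trans (le_sup (f := id) hf))
  have hpc : p.card = 2 := (mem_powersetCard.1 hp1).2
  have hint : 2 ≤ (e ∩ T.sup id).card := hpc ▸ card_le_card hpint
  have hui := card_union_add_card_inter e (T.sup id)
  have hs' : ((insert e T).sup id).card ≤ (insert e T).card + 2 := by
    rw [hsup, hc]; omega
  have hj' : (insert e T).card ≤ j := by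
    by_contra hcon
    have := hfreek _ hsub (by omega)
    omega
  refine ⟨hj', hs', ?_⟩
  have hlow := hfreel _ (by omega) hj' _ hsub rfl
  have hex : ∃ v ∈ e, v ∉ T.sup id := by
    by_contra! hcon
    have : e ∪ T.sup id = T.sup id := union_eq_right.2 hcon
    rw [hsup, this] at hlow
    have h2 : e ∩ T.sup id = e := inter_eq_left.2 hcon
    rw [hc] at hlow
    omega
  obtain ⟨v, hve, hvT⟩ := hex
  set N := (e.erase v).image (fun x => ({v, x} : Finset V)) with hN
  have hNc : N.card = 2 := by
    rw [hN, card_image_of_injOn, card_erase_of_mem hve, h3e]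
    intro x hx y hy hxy
    have hx' := mem_erase.1 (mem_coe.1 hx)
    have : x ∈ ({v, y} : Finset V) := by
      have hxy' : ({v, x} : Finset V) = {v, y} := hxy
      rw [← hxy']; simp
    simp only [mem_insert, mem_singleton] at this
    exact this.resolve_left hx'.1
  have hdis : Disjoint N (shadow2 T) := by
    rw [disjoint_left]
    intro q hq hqT
    obtain ⟨x, hx, rfl⟩ := mem_image.1 hq
    obtain ⟨f, hf, hqf⟩ := mem_biUnion.1 hqT
    have h1 := (mem_powersetCard.1 hqf).1
    exact hvT ((le_sup (f := id) hf) (h1 (mem_insert_self _ _)))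
  have hsubN : N ∪ shadow2 T ⊆ shadow2 (insert e T) := by
    intro q hq
    rcases mem_union.1 hq with hq | hq
    · obtain ⟨x, hx, rfl⟩ := mem_image.1 hq
      have hx' := mem_erase.1 hx
      refine mem_biUnion.2 ⟨e, mem_insert_self _ _, mem_powersetCard.2 ⟨?_, ?_⟩⟩
      · intro y hy
        simp only [mem_insert, mem_singleton] at hy
        rcases hy with rfl | rfl
        · exact hve
        · exact hx'.2
      · exact card_pair (Ne.symm hx'.1)
    · obtain ⟨f, hf, hqf⟩ := mem_biUnion.1 hq
      exact mem_biUnion.2 ⟨f, mem_insert_of_mem hf, hqf⟩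
  have := card_le_card hsubN
  rw [card_union_of_disjoint hdis] at this
  omega

theorem main_count {V : Type*} [DecidableEq V] (j : ℕ) (hj : 1 ≤ j) (n : ℕ) :
    ∀ (F : Finset (Finset V)), F.card = n → (∀ e ∈ F, e.card = 3) →
    (∀ T ⊆ F, T.card = j + 1 → j + 3 < (T.sup id).card) →
    (∀ l, 2 ≤ l → l ≤ j → ∀ T ⊆ F, T.card = l → l + 1 < (T.sup id).card) →
    F.card * (2 * j + 1) ≤ j * (shadow2 F).card := by
  induction n using Nat.strong_induction_on with
  | _ n ih =>
  intro F hFn h3 hfk hfl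
  rcases F.eq_empty_or_nonempty with rfl | ⟨e0, he0⟩
  · simp
  classical
  let S := F.powerset.filter (fun T => 1 ≤ T.card ∧ T.card ≤ j ∧
    (T.sup id).card ≤ T.card + 2 ∧ 2 * T.card + 1 ≤ (shadow2 T).card)
  have hS : S.Nonempty := by
    refine ⟨{e0}, mem_filter.2 ⟨mem_powerset.2 (singleton_subset_iff.2 he0), ?_⟩⟩
    have := h3 e0 he0
    simp [shadow2, card_powersetCard, this, hj]
    try decide
  obtain ⟨T, hTS, hmax⟩ := exists_max_image S card hS
  obtain ⟨hTF, h0, hTj, hs, hd⟩ := mem_filter.1 hTS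
  rw [mem_powerset] at hTF
  have hdisj : Disjoint (shadow2 T) (shadow2 (F \ T)) := by
    rw [disjoint_left]
    intro p hpT hpF
    obtain ⟨e, he, hpe⟩ := mem_biUnion.1 hpF
    obtain ⟨heF, heT⟩ := mem_sdiff.1 he
    obtain ⟨a, b, c⟩ := ext_step j F h3 hfk hfl T hTF h0 hTj hs hd e heF heT
      (not_disjoint_iff.2 ⟨p, hpe, hpT⟩)
    have hc : (insert e T).card = T.card + 1 := card_insert_of_notMem heT
    have := hmax (insert e T) (mem_filter.2
      ⟨mem_powerset.2 (insert_subset heF hTF), by omega, a, b, c⟩)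
    omega
  have hsd : (F \ T) ⊆ F := sdiff_subset
  have hcard : (F \ T).card + T.card = F.card := card_sdiff_add_card_eq_card hTF
  have hrec := ih (F \ T).card (by omega) (F \ T) rfl (fun e he => h3 e (hsd he))
    (fun U hU => hfk U (hU.trans hsd)) (fun l h1 h2 U hU => hfl l h1 h2 U (hU.trans hsd))
  have hu : shadow2 T ∪ shadow2 (F \ T) = shadow2 F := by
    unfold shadow2
    rw [← union_biUnion, union_sdiff_of_subset hTF]
  rw [← hu, card_union_of_disjoint hdisj, ← hcard]
  nlinarith [Nat.mul_le_mul_left j hd]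

/-- If `F` is a 3-uniform hypergraph on `n` vertices that is
`(k+2,k)`-free and `(ℓ+1,ℓ)`-free for all `ℓ ∈ [2,k-1]`, then
`e(F) ≤ (k-1)/(2k-1) * C(n,2) ≤ (k-1)/(4k-2) * n^2`. -/
theorem upper_bound_girth_free {V : Type*} [Fintype V] [DecidableEq V]
    (k : ℕ) (hk : 2 ≤ k) (F : Finset (Finset V)) (h3 : ∀ e ∈ F, e.card = 3)
    (hfreek : ∀ T ⊆ F, T.card = k → k + 2 < (T.sup id).card)
    (hfreeℓ : ∀ ℓ, 2 ≤ ℓ → ℓ ≤ k - 1 → ∀ T ⊆ F, T.card = ℓ → ℓ + 1 < (T.sup id).card) :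
    (F.card : ℝ) ≤ ((k : ℝ) - 1) / (2 * k - 1) * ((Fintype.card V).choose 2) ∧
      ((k : ℝ) - 1) / (2 * k - 1) * ((Fintype.card V).choose 2) ≤
        ((k : ℝ) - 1) / (4 * k - 2) * (Fintype.card V : ℝ) ^ 2 := by
  obtain ⟨j, rfl⟩ : ∃ j, k = j + 1 := ⟨k - 1, by omega⟩
  have hm := main_count j (by omega) _ F rfl h3 (fun T hT hc => hfreek T hT hc)
    (fun l h1 h2 => hfreeℓ l h1 (by omega))
  have hsh : (shadow2 F).card ≤ (Fintype.card V).choose 2 := by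
    rw [← card_univ, ← card_powersetCard]
    apply card_le_card
    intro p hp
    obtain ⟨e, _, hpe⟩ := mem_biUnion.1 hp
    exact mem_powersetCard.2 ⟨subset_univ _, (mem_powersetCard.1 hpe).2⟩
  have hm2 := hm.trans (Nat.mul_le_mul_left j hsh)
  have hm3 : (F.card : ℝ) * (2 * j + 1) ≤ j * ((Fintype.card V).choose 2 : ℕ) := by
    exact_mod_cast hm2
  have hj0 : (0 : ℝ) ≤ j := Nat.cast_nonneg j
  have e1 : ((j + 1 : ℕ) : ℝ) - 1 = j := by push_cast; ring
  have e2 : 2 * ((j + 1 : ℕ) : ℝ) - 1 = 2 * j + 1 := by push_cast; ring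
  have e3 : 4 * ((j + 1 : ℕ) : ℝ) - 2 = 2 * (2 * j + 1) := by push_cast; ring
  rw [e1, e2, e3]
  have hpos : (0 : ℝ) < 2 * j + 1 := by positivity
  constructor
  · rw [div_mul_eq_mul_div, le_div_iff₀ hpos]
    exact hm3
  · rw [Nat.cast_choose_two]
    have hn : (0 : ℝ) ≤ Fintype.card V := Nat.cast_nonneg _
    have : (j : ℝ) / (2 * (2 * j + 1)) * (Fintype.card V : ℝ) ^ 2
        = j / (2 * j + 1) * ((Fintype.card V : ℝ) ^ 2 / 2) := by
      field_simp
    rw [this]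
    apply mul_le_mul_of_nonneg_left _ (by positivity)
    nlinarith
end

section
/- Let $k \ge 2$ be an integer and let $F$ be a $(k+2,k)$-free $3$-uniform hypergraph with $v(F) \ge 8k^2$ and $e(F) \ge \frac{1}{6}(1 - \frac{1}{2k}) v(F)^2$. Then there exists a $(k+2,k)$-free subhypergraph $F'$ of $F$ that is also $(\ell+1,\ell)$-free for all $\ell \in [2,k-1]$ such that $v(F') \ge \frac{v(F)}{\sqrt{4k}}$ and $\frac{e(F')}{v(F')^2} \ge \frac{e(F)}{v(F)^2}$. -/
open Finset

namespace BES

variable {V : Type*} [DecidableEq V]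

/-- crossing edges with outside part in `X` -/
def E1 (F : Finset (Finset V)) (S X : Finset V) : Finset (Finset V) :=
  F.filter (fun e => (e ∩ S).card = 1 ∧ e \ S ⊆ X)

/-- induced edges -/
def ind (F : Finset (Finset V)) (U : Finset V) : Finset (Finset V) :=
  F.filter (fun e => e ⊆ U)

lemma free_ind {F : Finset (Finset V)} {k : ℕ}
    (hfree : ∀ T ⊆ F, T.card = k → k + 2 < (T.sup id).card) {W : Finset V}
    (hW : W.card ≤ k + 2) : (ind F W).card < k := by
  by_contra h
  push Not at h
  obtain ⟨T, hT, hc⟩ := Finset.exists_subset_card_eq h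
  have h1 := hfree T (hT.trans (Finset.filter_subset _ _)) hc
  have h2 : T.sup id ⊆ W := by
    apply Finset.sup_le
    intro e he
    exact (Finset.mem_filter.1 (hT he)).2
  have := Finset.card_le_card h2
  omega

lemma codeg {F : Finset (Finset V)} {k : ℕ} (h3 : ∀ e ∈ F, e.card = 3)
    (hfree : ∀ T ⊆ F, T.card = k → k + 2 < (T.sup id).card) {x y : V} (hxy : x ≠ y) :
    (F.filter (fun e => x ∈ e ∧ y ∈ e)).card < k := by
  by_contra h
  push Not at h
  obtain ⟨T, hT, hc⟩ := Finset.exists_subset_card_eq h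
  have h1 := hfree T (hT.trans (Finset.filter_subset _ _)) hc
  have h2 : T.sup id ⊆ {x, y} ∪ T.biUnion (fun e => e \ {x, y}) := by
    apply Finset.sup_le
    intro e he z hz
    simp only [id] at hz
    by_cases hz' : z ∈ ({x, y} : Finset V)
    · exact mem_union_left _ hz'
    · exact mem_union_right _ (mem_biUnion.2 ⟨e, he, mem_sdiff.2 ⟨hz, hz'⟩⟩)
  have h4 : (T.biUnion (fun e => e \ {x, y})).card ≤ T.card * 1 := by
    apply Finset.card_biUnion_le_card_mul
    intro e he
    have := Finset.mem_filter.1 (hT he)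
    rw [Finset.card_sdiff_of_subset (by intro z; simp; rintro (rfl | rfl); exacts [this.2.1, this.2.2]),
      h3 e this.1, Finset.card_pair hxy]
  have := Finset.card_le_card h2
  have h5 := Finset.card_union_le ({x, y} : Finset V) (T.biUnion (fun e => e \ {x, y}))
  rw [Finset.card_pair hxy] at h5
  omega

lemma upper {F : Finset (Finset V)} {k : ℕ} (h3 : ∀ e ∈ F, e.card = 3)
    (hfree : ∀ T ⊆ F, T.card = k → k + 2 < (T.sup id).card) (U : Finset V) :
    (ind F U).card * 6 ≤ (U.card * U.card) * (k - 1) := by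
  have key := Finset.card_mul_le_card_mul (s := ind F U) (t := U.offDiag)
    (fun e p => p.1 ∈ e ∧ p.2 ∈ e) (m := 6) (n := k - 1) ?_ ?_
  · refine key.trans (Nat.mul_le_mul_right _ ?_)
    rw [Finset.offDiag_card]; omega
  · intro e he
    obtain ⟨heF, heU⟩ := Finset.mem_filter.1 he
    have : e.offDiag ⊆ bipartiteAbove (fun e p => p.1 ∈ e ∧ p.2 ∈ e) U.offDiag e := by
      intro p hp
      rw [mem_offDiag] at hp
      simp only [mem_bipartiteAbove, mem_offDiag]
      exact ⟨⟨heU hp.1, heU hp.2.1, hp.2.2⟩, hp.1, hp.2.1⟩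
    have := Finset.card_le_card this
    rw [Finset.offDiag_card, h3 e heF] at this
    omega
  · intro p hp
    rw [mem_offDiag] at hp
    have h1 := codeg h3 hfree hp.2.2
    have : bipartiteBelow (fun e p => p.1 ∈ e ∧ p.2 ∈ e) (ind F U) p
        ⊆ F.filter (fun e => p.1 ∈ e ∧ p.2 ∈ e) := by
      intro e he
      rw [mem_bipartiteBelow] at he
      exact mem_filter.2 ⟨(mem_filter.1 he.1).1, he.2⟩
    have := Finset.card_le_card this
    omega

lemma ind_union (F : Finset (Finset V)) (S W : Finset V) :
    (ind F S).card + (E1 F S W).card ≤ (ind F (S ∪ W)).card + (F.filter (fun e => e ⊆ S ∧ e.card ≤ 1)).card := by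
  have hsub : ind F S ∪ E1 F S W ⊆ ind F (S ∪ W) := by
    intro e he
    rw [mem_union] at he
    refine mem_filter.2 ?_
    rcases he with he | he
    · obtain ⟨h1, h2⟩ := mem_filter.1 he
      exact ⟨h1, h2.trans subset_union_left⟩
    · obtain ⟨h1, h2, h4⟩ := mem_filter.1 he
      refine ⟨h1, fun z hz => ?_⟩
      by_cases hzS : z ∈ S
      · exact mem_union_left _ hzS
      · exact mem_union_right _ (h4 (mem_sdiff.2 ⟨hz, hzS⟩))
  have hint : ind F S ∩ E1 F S W ⊆ F.filter (fun e => e ⊆ S ∧ e.card ≤ 1) := by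
    intro e he
    rw [mem_inter] at he
    obtain ⟨h1, h2⟩ := mem_filter.1 he.1
    obtain ⟨_, h4, _⟩ := mem_filter.1 he.2
    rw [inter_eq_left.2 h2] at h4
    exact mem_filter.2 ⟨h1, h2, h4.le⟩
  have := card_le_card hsub
  have := card_le_card hint
  have := card_union_add_card_inter (ind F S) (E1 F S W)
  omega

lemma ind_union' {F : Finset (Finset V)} (h3 : ∀ e ∈ F, e.card = 3) (S W : Finset V) :
    (ind F S).card + (E1 F S W).card ≤ (ind F (S ∪ W)).card := by
  have := ind_union F S W
  have h : F.filter (fun e => e ⊆ S ∧ e.card ≤ 1) = ∅ := by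
    apply filter_eq_empty_iff.2
    intro e he
    rw [h3 e he]
    omega
  rw [h] at this
  simpa using this

/-- the forest bound -/
lemma forest {F : Finset (Finset V)} {k l : ℕ} (h3 : ∀ e ∈ F, e.card = 3)
    (hfree : ∀ T ⊆ F, T.card = k → k + 2 < (T.sup id).card)
    (U S : Finset V) (hSU : S ⊆ U) (hl : l < k) (hS : S.card = l + 1) (hSe : l ≤ (ind F S).card)
    (hmax : ∀ j, l < j → j ≤ k → ∀ S' ⊆ U, S'.card = j + 1 → (ind F S').card < j) :
    ∀ (n : ℕ) (X : Finset V), X.card = n → X ⊆ U \ S →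
      k * (E1 F S X).card ≤ (k - 1) * X.card := by
  intro n
  induction n using Nat.strong_induction_on with
  | _ n ih =>
  intro X hXn hX
  have hcard : ∀ W ⊆ X, (S ∪ W).card = l + 1 + W.card := by
    intro W hW
    rw [card_union_of_disjoint, hS]
    rw [disjoint_left]
    intro a ha hb
    exact (mem_sdiff.1 (hX (hW hb))).2 ha
  have hUW : ∀ W ⊆ X, S ∪ W ⊆ U := fun W hW =>
    union_subset hSU ((hW.trans hX).trans sdiff_subset)
  rcases X.eq_empty_or_nonempty with rfl | ⟨v, hv⟩
  · have : E1 F S ∅ = ∅ := by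
      apply filter_eq_empty_iff.2
      rintro e he ⟨h1, h2⟩
      have : e \ S = ∅ := subset_empty.1 h2
      rw [sdiff_eq_empty_iff_subset] at this
      rw [inter_eq_left.2 this, h3 e he] at h1
      omega
    simp [this]
  · let C := X.powerset.filter (fun W => v ∈ W ∧ W.card ≤ k - l ∧ W.card ≤ (E1 F S W).card + 1)
    have hC : C.Nonempty := by
      refine ⟨{v}, mem_filter.2 ⟨by simpa using hv, by simp, ?_, ?_⟩⟩
      · simp; omega
      · simp
    obtain ⟨W, hWC, hWmax⟩ := exists_max_image C card hC
    obtain ⟨hWX, hvW, hWk, hWt⟩ := mem_filter.1 hWC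
    rw [mem_powerset] at hWX
    have hWpos : 0 < W.card := card_pos.2 ⟨v, hvW⟩
    have hWlt : (E1 F S W).card < W.card := by
      by_contra hcon
      have h1 := hmax (l + W.card) (by omega) (by omega) (S ∪ W) (hUW W hWX)
        (by rw [hcard W hWX]; omega)
      have h2 := ind_union' h3 S W
      omega
    -- no crossing
    have hsplit : E1 F S X ⊆ E1 F S W ∪ E1 F S (X \ W) := by
      intro e he
      obtain ⟨heF, he1, heX⟩ := mem_filter.1 he
      by_contra hcon
      rw [mem_union, not_or] at hcon
      obtain ⟨hc1, hc2⟩ := hcon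
      have hn1 : ¬ (e \ S ⊆ W) := fun h => hc1 (mem_filter.2 ⟨heF, he1, h⟩)
      have hn2 : ¬ (e \ S ⊆ X \ W) := fun h => hc2 (mem_filter.2 ⟨heF, he1, h⟩)
      obtain ⟨y, hy, hyW⟩ := not_subset.1 hn1
      obtain ⟨x, hx, hxW⟩ := not_subset.1 hn2
      have hxW : x ∈ W := by
        by_contra h
        exact hxW (mem_sdiff.2 ⟨heX hx, h⟩)
      have hxy : x ≠ y := by rintro rfl; exact hyW hxW
      have hc : (e \ S).card = 2 := by
        have := card_sdiff_add_card_inter e S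
        rw [h3 e heF] at this; omega
      have hexy : e \ S = {x, y} := by
        symm
        apply eq_of_subset_of_card_le
        · intro z; simp only [mem_insert, mem_singleton]; rintro (rfl | rfl) <;> assumption
        · rw [hc, card_pair hxy]
      have hyX : y ∈ X := heX hy
      have hsub : insert e (E1 F S W) ⊆ E1 F S (insert y W) := by
        intro f hf
        rw [mem_insert] at hf
        rcases hf with rfl | hf
        · refine mem_filter.2 ⟨heF, he1, ?_⟩
          rw [hexy]
          intro z; simp only [mem_insert, mem_singleton]
          rintro (rfl | rfl)
          · right; exact hxW
          · left; rfl
        · obtain ⟨a, b, c⟩ := mem_filter.1 hf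
          exact mem_filter.2 ⟨a, b, c.trans (subset_insert _ _)⟩
      have h1 := card_le_card hsub
      rw [card_insert_of_notMem hc1] at h1
      have h2 : (insert y W).card = W.card + 1 := card_insert_of_notMem hyW
      have hsubX : insert y W ⊆ X := insert_subset hyX hWX
      by_cases hk : W.card + 1 ≤ k - l
      · have := hWmax (insert y W) (mem_filter.2 ⟨mem_powerset.2 hsubX,
          mem_insert_of_mem hvW, by omega, by omega⟩)
        omega
      · have h4 := ind_union' h3 S (insert y W)
        have h5 := hcard _ hsubX
        have h6 := free_ind hfree (W := S ∪ insert y W) (by omega)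
        omega
    have h1 := card_le_card hsplit
    have h2 := card_union_le (E1 F S W) (E1 F S (X \ W))
    have h4 : (X \ W).card = X.card - W.card := card_sdiff_of_subset hWX
    have h5 := card_le_card hWX
    have h6 := ih (X \ W).card (by omega) (X \ W) rfl (sdiff_subset.trans hX)
    have h7 : k * (E1 F S W).card ≤ (k - 1) * W.card := by
      obtain ⟨k', rfl⟩ : ∃ k', k = k' + 1 := ⟨k - 1, by omega⟩
      simp only [Nat.add_sub_cancel]
      have : (E1 F S W).card + 1 ≤ W.card := hWlt
      have : W.card ≤ k' + 1 := by omega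
      nlinarith
    calc k * (E1 F S X).card ≤ k * ((E1 F S W).card + (E1 F S (X \ W)).card) :=
          Nat.mul_le_mul_left _ (h1.trans h2)
      _ ≤ (k - 1) * W.card + (k - 1) * (X \ W).card := by rw [mul_add]; omega
      _ = (k - 1) * X.card := by rw [← mul_add]; congr 1; omega

/-- a maximal dense set, and how few edges touch it -/
lemma step {F : Finset (Finset V)} {k l : ℕ} (h3 : ∀ e ∈ F, e.card = 3)
    (hfree : ∀ T ⊆ F, T.card = k → k + 2 < (T.sup id).card)
    (U : Finset V) (hUk : k + 1 < U.card) (hl2 : 2 ≤ l) (hlk : l ≤ k - 1)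
    (T : Finset (Finset V)) (hT : T ⊆ ind F U) (hTl : T.card = l)
    (hbad : (T.sup id).card ≤ l + 1) :
    ∃ a : ℕ, 4 ≤ a ∧ a ≤ k ∧ ∃ U' ⊆ U, U'.card + a = U.card ∧
      k * (ind F U).card ≤ k * (ind F U').card + k * (a - 1) + (k - 1) * U'.card := by
  classical
  let P : ℕ → Prop := fun j => ∃ S ⊆ U, S.card = j + 1 ∧ j ≤ (ind F S).card
  have hPl : P l := by
    have hs : T.sup id ⊆ U := by
      apply Finset.sup_le
      intro e he
      exact (mem_filter.1 (hT he)).2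
    obtain ⟨S, hS1, hS2, hS3⟩ := exists_subsuperset_card_eq hs hbad (by omega)
    refine ⟨S, hS2, hS3, ?_⟩
    rw [← hTl]
    apply card_le_card
    intro e he
    refine mem_filter.2 ⟨(mem_filter.1 (hT he)).1, ?_⟩
    have : e ≤ T.sup id := le_sup (f := id) he
    exact subset_trans this hS1
  let L := Nat.findGreatest P k
  have hL : P L := Nat.findGreatest_spec (P := P) (m := l) (by omega) hPl
  have hlL : l ≤ L := Nat.le_findGreatest (by omega) hPl
  have hLk' : L ≤ k := Nat.findGreatest_le k
  have hmax : ∀ j, L < j → j ≤ k → ∀ S' ⊆ U, S'.card = j + 1 → (ind F S').card < j := by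
    intro j h1 h2 S' hS' hc
    by_contra hcon
    exact Nat.findGreatest_is_greatest (P := P) h1 h2 ⟨S', hS', hc, not_lt.1 hcon⟩
  obtain ⟨S, hSU, hS, hSe⟩ := hL
  clear_value L
  have hLk : L < k := by
    rcases hLk'.lt_or_eq with h | rfl
    · exact h
    · have := free_ind hfree (W := S) (by omega)
      omega
  have hL3 : 3 ≤ L := by
    by_contra hcon
    have hL2 : L = 2 := by omega
    subst hL2
    have : ind F S ⊆ {S} := by
      intro e he
      obtain ⟨h1, h2⟩ := mem_filter.1 he
      rw [mem_singleton]
      exact eq_of_subset_of_card_le h2 (by rw [h3 e h1, hS])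
    have := card_le_card this
    rw [card_singleton] at this
    omega
  have hin : (ind F S).card ≤ L := by
    by_contra hcon
    obtain ⟨S', hS1, hS2, hS3⟩ := exists_subsuperset_card_eq hSU (n := L + 2) (by omega) (by omega)
    have h1 := hmax (L + 1) (by omega) (by omega) S' hS2 hS3
    have h2 : ind F S ⊆ ind F S' := by
      intro e he
      obtain ⟨h1, h2⟩ := mem_filter.1 he
      exact mem_filter.2 ⟨h1, h2.trans hS1⟩
    have := card_le_card h2
    omega
  have htwo : ∀ e ∈ ind F U, (e ∩ S).card ≠ 2 := by
    intro e he h2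
    obtain ⟨heF, heU⟩ := mem_filter.1 he
    have hc : (S ∪ e).card = L + 2 := by
      have := card_union_add_card_inter S e
      rw [inter_comm, h2, hS, h3 e heF] at this
      omega
    have h1 := hmax (L + 1) (by omega) (by omega) (S ∪ e) (union_subset hSU heU) hc
    have hne : e ∉ ind F S := by
      intro h
      have := (mem_filter.1 h).2
      rw [inter_eq_left.2 this, h3 e heF] at h2
      omega
    have hsub : insert e (ind F S) ⊆ ind F (S ∪ e) := by
      intro f hf
      rcases mem_insert.1 hf with rfl | hf
      · exact mem_filter.2 ⟨heF, subset_union_right⟩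
      · obtain ⟨a, b⟩ := mem_filter.1 hf
        exact mem_filter.2 ⟨a, b.trans subset_union_left⟩
    have := card_le_card hsub
    rw [card_insert_of_notMem hne] at this
    omega
  have hcU : (U \ S).card = U.card - S.card := card_sdiff_of_subset hSU
  have hSUc := card_le_card hSU
  refine ⟨L + 1, by omega, by omega, U \ S, sdiff_subset, by omega, ?_⟩
  have hf := forest h3 hfree U S hSU hLk hS hSe hmax _ (U \ S) rfl (Subset.refl _)
  have hcover : ind F U ⊆ ind F (U \ S) ∪ (ind F S ∪ E1 F S (U \ S)) := by
    intro e he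
    have h2 := htwo e he
    obtain ⟨heF, heU⟩ := mem_filter.1 he
    have h4 : (e ∩ S).card ≤ 3 := by
      rw [← h3 e heF]; exact card_le_card inter_subset_left
    rw [mem_union, mem_union]
    have : (e ∩ S).card = 0 ∨ (e ∩ S).card = 1 ∨ (e ∩ S).card = 3 := by omega
    rcases this with h | h | h
    · left
      refine mem_filter.2 ⟨heF, subset_sdiff.2 ⟨heU, ?_⟩⟩
      rw [disjoint_iff_inter_eq_empty]
      exact card_eq_zero.1 h
    · right; right
      exact mem_filter.2 ⟨heF, h, sdiff_subset_sdiff heU (Subset.refl _)⟩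
    · right; left
      refine mem_filter.2 ⟨heF, ?_⟩
      rw [← inter_eq_left]
      exact eq_of_subset_of_card_le inter_subset_left (by rw [h, h3 e heF])
  have h1 := card_le_card hcover
  have h2 := card_union_le (ind F (U \ S)) (ind F S ∪ E1 F S (U \ S))
  have h4 := card_union_le (ind F S) (E1 F S (U \ S))
  have h5 : k * (ind F S).card ≤ k * L := Nat.mul_le_mul_left _ hin
  have h6 := Nat.mul_le_mul_left k ((h1.trans h2).trans (Nat.add_le_add_left h4 _))
  rw [mul_add, mul_add] at h6
  simp only [Nat.add_sub_cancel]
  omega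

/-- numerical step inequality, `m = u + a` -/
lemma num_step (k a u : ℝ) (hk : 4 ≤ k) (ha : 4 ≤ a) (hak : a ≤ k) (hm : 8 * k ≤ u + a) :
    k * (a - 1) + (k - 1) * u ≤ k * ((1 - 1 / (2 * k)) / 8 * ((u + a) ^ 2 - u ^ 2)) := by
  have : k * ((1 - 1 / (2 * k)) / 8 * ((u + a) ^ 2 - u ^ 2))
      = (2 * k - 1) / 16 * (a * (2 * u + a)) := by
    field_simp
    ring
  rw [this]
  obtain ⟨b, rfl⟩ : ∃ b, a = b + 4 := ⟨a - 4, by ring⟩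
  have hb : 0 ≤ b := by linarith
  have hu : 7 * k ≤ u := by linarith
  have h1 : 0 ≤ b * (2 * k - 1) * (u - 7 * k) :=
    mul_nonneg (mul_nonneg hb (by linarith)) (by linarith)
  have h2 : 0 ≤ b * (k - 4) := mul_nonneg hb (by linarith)
  have h4 : 0 ≤ b * k * (k - 4) := mul_nonneg (mul_nonneg hb (by linarith)) (by linarith)
  have h5 : 0 ≤ b * b * (2 * k - 1) := mul_nonneg (mul_nonneg hb hb) (by linarith)
  nlinarith

end BES

set_option maxHeartbeats 2000000 in
theorem exists_large_dense_free_subgraph {V : Type*} [Fintype V] [DecidableEq V]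
    (k : ℕ) (hk : 2 ≤ k) (F : Finset (Finset V)) (h3 : ∀ e ∈ F, e.card = 3)
    (hfree : ∀ T ⊆ F, T.card = k → k + 2 < (T.sup id).card)
    (hv : 8 * k ^ 2 ≤ Fintype.card V)
    (he : 1 / 6 * (1 - 1 / (2 * (k : ℝ))) * (Fintype.card V : ℝ) ^ 2 ≤ F.card) :
    ∃ U : Finset V, ∃ F' : Finset (Finset V), F' = F.filter (fun e => e ⊆ U) ∧
      (∀ T ⊆ F', T.card = k → k + 2 < (T.sup id).card) ∧
      (∀ ℓ, 2 ≤ ℓ → ℓ ≤ k - 1 → ∀ T ⊆ F', T.card = ℓ → ℓ + 1 < (T.sup id).card) ∧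
      (Fintype.card V : ℝ) / Real.sqrt (4 * k) ≤ U.card ∧
      (F.card : ℝ) / (Fintype.card V : ℝ) ^ 2 ≤ (F'.card : ℝ) / (U.card : ℝ) ^ 2 := by
  classical
  set n : ℝ := (Fintype.card V : ℝ) with hn
  have hk2 : (2 : ℝ) ≤ k := by exact_mod_cast hk
  have hnk : 8 * (k : ℝ) ^ 2 ≤ n := by rw [hn]; exact_mod_cast hv
  have hnpos : 0 < n := by nlinarith
  set q : ℝ := 1 - 1 / (2 * (k : ℝ)) with hq
  have hqk : q * k = k - 1 / 2 := by rw [hq]; field_simp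
  have hq34 : 3 / 4 ≤ q := by
    have : 0 ≤ (q - 3 / 4) * k := by nlinarith
    nlinarith [nonneg_of_mul_nonneg_left this (by linarith)]
  let C : Finset (Finset V) := univ.filter (fun U =>
    (F.card : ℝ) - q / 8 * (n ^ 2 - (U.card : ℝ) ^ 2) ≤ (BES.ind F U).card)
  have hC : C.Nonempty := by
    refine ⟨univ, mem_filter.2 ⟨mem_univ _, ?_⟩⟩
    simp [BES.ind, hn]
  obtain ⟨U, hUC, hUmin⟩ := exists_min_image C card hC
  have hU := (mem_filter.1 hUC).2
  set m : ℝ := (U.card : ℝ) with hm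
  have hm0 : 0 ≤ m := by positivity
  have hup : ((BES.ind F U).card : ℝ) * 6 ≤ m * m * (k - 1) := by
    have := BES.upper h3 hfree U
    have h' : ((k - 1 : ℕ) : ℝ) = k - 1 := by push_cast [Nat.cast_sub (by omega : 1 ≤ k)]; ring
    rw [hm, ← h']
    exact_mod_cast this
  -- size bound
  have hsize : n ^ 2 ≤ 4 * k * m ^ 2 := by
    have h1 : q / 24 * n ^ 2 ≤ m ^ 2 * ((k - 1) / 6 - q / 8) := by nlinarith
    have h2 : m ^ 2 * ((k - 1) / 6 - q / 8) ≤ m ^ 2 * (q / 24 * (4 * k)) :=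
      mul_le_mul_of_nonneg_left (by nlinarith) (by positivity)
    have h4 : q / 24 * n ^ 2 ≤ q / 24 * (4 * k * m ^ 2) := by nlinarith
    exact le_of_mul_le_mul_left h4 (by linarith)
  have hmn : m ≤ n := by
    rw [hm, hn]; exact_mod_cast card_le_univ U
  have hmpos : 0 < m := by
    rcases hm0.lt_or_eq with h | h
    · exact h
    · rw [← h] at hsize; nlinarith
  refine ⟨U, BES.ind F U, rfl, fun T hT => hfree T (hT.trans (filter_subset _ _)), ?_, ?_, ?_⟩
  · intro l hl2 hlk T hT hTl
    by_contra hbad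
    push Not at hbad
    -- m ≥ 8k when k ≥ 4
    have hbig : 4 ≤ k → 8 * (k : ℝ) ≤ m := by
      intro h4
      have h4' : (4 : ℝ) ≤ k := by exact_mod_cast h4
      by_contra hcon
      push Not at hcon
      have a1 : m ^ 2 < (8 * (k : ℝ)) ^ 2 := by nlinarith
      have a2 : (8 * (k : ℝ) ^ 2) ^ 2 ≤ n ^ 2 := by
        apply pow_le_pow_left₀ (by positivity) hnk
      have a3 : 4 * (k : ℝ) * m ^ 2 < 4 * k * (8 * (k : ℝ)) ^ 2 :=
        mul_lt_mul_of_pos_left a1 (by linarith)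
      have a4 : 0 ≤ (k : ℝ) ^ 3 * (k - 4) := mul_nonneg (by positivity) (by linarith)
      nlinarith
    have hbig' : k + 1 < U.card := by
      have : (k : ℝ) + 1 < m := by
        by_contra hcon
        push Not at hcon
        have a1 : m ^ 2 ≤ ((k : ℝ) + 1) ^ 2 := by nlinarith
        have a1' : ((k : ℝ) + 1) ^ 2 ≤ (2 * k) ^ 2 := by nlinarith
        have a2 : (8 * (k : ℝ) ^ 2) ^ 2 ≤ n ^ 2 := by
          apply pow_le_pow_left₀ (by positivity) hnk
        have a3 : 4 * (k : ℝ) * m ^ 2 ≤ 4 * k * (2 * (k : ℝ)) ^ 2 :=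
          mul_le_mul_of_nonneg_left (a1.trans a1') (by linarith)
        have a4 : 0 ≤ (k : ℝ) ^ 3 * (k - 2) := mul_nonneg (by positivity) (by linarith)
        have a5 : 0 < (k : ℝ) ^ 3 := by positivity
        nlinarith
      rw [hm] at this
      exact_mod_cast this
    obtain ⟨a, ha4, hak, U', hU'U, hU'c, hloss⟩ :=
      BES.step h3 hfree U hbig' hl2 hlk T hT hTl hbad
    have hu : m = (U'.card : ℝ) + a := by rw [hm]; exact_mod_cast hU'c.symm
    have hns := BES.num_step k a U'.card (by exact_mod_cast ha4.trans hak) (by exact_mod_cast ha4)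
      (by exact_mod_cast hak) (by rw [← hu]; exact hbig (ha4.trans hak))
    rw [← hq, ← hu] at hns
    have hloss' : (k : ℝ) * (BES.ind F U).card ≤
        k * (BES.ind F U').card + k * (a - 1) + (k - 1) * U'.card := by
      have h' : ((k - 1 : ℕ) : ℝ) = k - 1 := by push_cast [Nat.cast_sub (by omega : 1 ≤ k)]; ring
      have h'' : ((a - 1 : ℕ) : ℝ) = a - 1 := by push_cast [Nat.cast_sub (by omega : 1 ≤ a)]; ring
      rw [← h', ← h'']
      exact_mod_cast hloss
    have hfin : ((BES.ind F U).card : ℝ) ≤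
        (BES.ind F U').card + q / 8 * (m ^ 2 - (U'.card : ℝ) ^ 2) := by
      apply le_of_mul_le_mul_left _ (by linarith : (0 : ℝ) < k)
      rw [mul_add]
      linarith
    have := hUmin U' (mem_filter.2 ⟨mem_univ _, by linarith⟩)
    omega
  · rw [div_le_iff₀ (by positivity)]
    refine (sq_le_sq₀ (by positivity) (by positivity)).1 ?_
    rw [mul_pow, Real.sq_sqrt (by positivity)]
    linarith
  · rw [div_le_div_iff₀ (by positivity) (by positivity)]
    have h1 : 0 ≤ (n ^ 2 - m ^ 2) * (F.card - q / 8 * n ^ 2) := by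
      apply mul_nonneg
      · nlinarith
      · nlinarith [sq_nonneg n]
    have h2 := mul_le_mul_of_nonneg_right hU (sq_nonneg n)
    nlinarith
end

section
/- For every integer $k \ge 2$, $\limsup_{n \to \infty} n^{-2} f^{(3)}(n;k+2,k) = \limsup_{n \to \infty} n^{-2} g^{(3)}(n;k+2,k)$, where $f^{(3)}(n;k+2,k)$ is the maximum number of edges in a $(k+2,k)$-free $3$-uniform hypergraph on $n$ vertices, and $g^{(3)}(n;k+2,k)$ is the maximum number of edges in a $3$-uniform hypergraph on $n$ vertices that is $(k+2,k)$-free and also $(\ell+1,\ell)$-free for all $\ell \in [2,k-1]$. -/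
open Finset Filter

/-- `f^(3)(n; k+2, k)`: the maximum number of edges of a `(k+2,k)`-free 3-uniform
hypergraph on `n` vertices. -/
noncomputable def fBES (k n : ℕ) : ℕ :=
  sSup { m | ∃ F : Finset (Finset (Fin n)), (∀ e ∈ F, e.card = 3) ∧
    (∀ S ⊆ F, S.card = k → k + 2 < (S.sup id).card) ∧ F.card = m }

/-- `g^(3)(n; k+2, k)`: the maximum number of edges of a 3-uniform hypergraph on `n`
vertices that is `(k+2,k)`-free and `(ℓ+1,ℓ)`-free for all `ℓ ∈ [2, k-1]`. -/
noncomputable def gBES (k n : ℕ) : ℕ :=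
  sSup { m | ∃ F : Finset (Finset (Fin n)), (∀ e ∈ F, e.card = 3) ∧
    (∀ S ⊆ F, S.card = k → k + 2 < (S.sup id).card) ∧
    (∀ ℓ, 2 ≤ ℓ → ℓ ≤ k - 1 → ∀ S ⊆ F, S.card = ℓ → ℓ + 1 < (S.sup id).card) ∧
    F.card = m }

theorem core_free {α : Type*} [DecidableEq α] (k : ℕ) (F : Finset (Finset α)) (V : Finset α)
    (h3 : ∀ e ∈ F, e.card = 3) (hV : ∀ e ∈ F, e ⊆ V)
    (hfree : ∀ S ⊆ F, S.card = k → k + 2 < (S.sup id).card)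
    (hdeg : ∀ v ∈ V, V.card + 4 * k ≤ 4 * (F.filter (fun e => v ∈ e)).card) :
    ∀ ℓ, 2 ≤ ℓ → ℓ ≤ k - 1 → ∀ S ⊆ F, S.card = ℓ → ℓ + 1 < (S.sup id).card := by
  intro ℓ hl2 hlk S0 hS0 hS0c
  by_contra hcon
  obtain ⟨S, hS, hmax⟩ := Finset.exists_max_image
    (F.powerset.filter (fun S => 2 ≤ S.card ∧ S.card ≤ k - 1 ∧ (S.sup id).card ≤ S.card + 1))
    Finset.card ⟨S0, by simp only [mem_filter, mem_powerset]; exact ⟨hS0, by omega, by omega, by omega⟩⟩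
  simp only [mem_filter, mem_powerset] at hS hmax
  obtain ⟨hSF, hS2, hSk, hSU⟩ := hS
  set U := S.sup id with hU
  have hUV : U ⊆ V := by
    intro x hx
    obtain ⟨e, he, hxe⟩ := Finset.mem_sup.1 hx
    exact hV e (hSF he) hxe
  -- general extension principle
  have hext : ∀ A ⊆ F \ S, A.Nonempty → S.card + A.card ≤ k → (A.sup id \ U).card ≤ A.card → False := by
    intro A hA hAne hle hc
    have hdisj : Disjoint S A := by
      rw [Finset.disjoint_left]; intro e he he'
      exact (Finset.mem_sdiff.1 (hA he')).2 he
    have hAF : S ∪ A ⊆ F := Finset.union_subset hSF (fun e he => (Finset.mem_sdiff.1 (hA he)).1)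
    have hcard : (S ∪ A).card = S.card + A.card := Finset.card_union_of_disjoint hdisj
    have hsup : ((S ∪ A).sup id).card ≤ U.card + (A.sup id \ U).card := by
      rw [Finset.sup_union, ← hU]
      have : U ⊔ A.sup id = U ∪ (A.sup id \ U) := by simp
      rw [this]; exact Finset.card_union_le _ _
    have hp := hAne.card_pos
    by_cases hk : S.card + A.card = k
    · have := hfree _ hAF (by omega); omega
    · have := hmax (S ∪ A) ⟨hAF, by omega, by omega, by omega⟩
      omega
  have h1 : ∀ e ∈ F \ S, (e ∩ U).card ≤ 1 := by
    intro e he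
    by_contra hc
    have h3e := h3 e (Finset.mem_sdiff.1 he).1
    have := Finset.card_sdiff_add_card_inter e U
    refine hext {e} (by simpa using he) (by simp) (by simp; omega) ?_
    simp only [sup_singleton, id, card_singleton]
    omega
  set E := (F \ S).filter (fun e => (e ∩ U).Nonempty) with hE
  have hU4 : 4 ≤ U.card := by
    obtain ⟨a, ha, b, hb, hab⟩ := Finset.one_lt_card.1 (show 1 < S.card by omega)
    have haU : a ⊆ U := Finset.le_sup (f := id) ha
    have hbU : b ⊆ U := Finset.le_sup (f := id) hb
    have h3a := h3 a (hSF ha)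
    have h3b := h3 b (hSF hb)
    by_contra hc
    have e1 := Finset.eq_of_subset_of_card_le haU (by omega)
    have e2 := Finset.eq_of_subset_of_card_le hbU (by omega)
    exact hab (e1.trans e2.symm)
  have hcount : ∑ u ∈ U, (E.filter (fun e => u ∈ e)).card ≤ E.card := by
    have := Finset.sum_card_bipartiteAbove_eq_sum_card_bipartiteBelow (s := U) (t := E)
      (fun (u : α) (e : Finset α) => u ∈ e)
    simp only [Finset.bipartiteAbove, Finset.bipartiteBelow] at this
    rw [this, Finset.card_eq_sum_ones]
    refine Finset.sum_le_sum fun e he => ?_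
    have h := h1 e (Finset.mem_filter.1 he).1
    rwa [Finset.inter_comm, ← Finset.filter_mem_eq_inter] at h
  have hdegE : ∀ u ∈ U, V.card ≤ 4 * (E.filter (fun e => u ∈ e)).card := by
    intro u hu
    have hd := hdeg u (hUV hu)
    have : F.filter (fun e => u ∈ e) ⊆ E.filter (fun e => u ∈ e) ∪ S := by
      intro e he
      rw [Finset.mem_filter] at he
      by_cases heS : e ∈ S
      · exact Finset.mem_union_right _ heS
      · refine Finset.mem_union_left _ ?_
        simp only [hE, Finset.mem_filter, Finset.mem_sdiff]
        exact ⟨⟨⟨he.1, heS⟩, ⟨u, Finset.mem_inter.2 ⟨he.2, hu⟩⟩⟩, he.2⟩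
    have h' := (Finset.card_le_card this).trans (Finset.card_union_le _ _)
    omega
  have hEV : V.card ≤ E.card := by
    have h := Finset.sum_le_sum hdegE
    rw [← Finset.mul_sum, Finset.sum_const, smul_eq_mul] at h
    have : 4 * V.card ≤ U.card * V.card := Nat.mul_le_mul_right _ hU4
    omega
  have hVpos : 4 ≤ V.card := hU4.trans (Finset.card_le_card hUV)
  have hEF : E ⊆ F \ S := Finset.filter_subset _ _
  have hE2 : ∀ e ∈ E, (e \ U).card ≤ 2 := by
    intro e he
    have hne := (Finset.mem_filter.1 he).2.card_pos
    have h3e := h3 e (Finset.mem_sdiff.1 (hEF he)).1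
    have := Finset.card_sdiff_add_card_inter e U
    omega
  obtain ⟨T, hT, hmin⟩ := Finset.exists_min_image
    (E.powerset.filter (fun T => T.Nonempty ∧ (T.sup id \ U).card ≤ T.card))
    Finset.card ⟨E, by
      simp only [mem_filter, mem_powerset]
      refine ⟨subset_rfl, Finset.card_pos.1 (by omega), le_trans (Finset.card_le_card ?_) hEV⟩
      intro x hx
      obtain ⟨e, he, hxe⟩ := Finset.mem_sup.1 (Finset.mem_sdiff.1 hx).1
      exact hV e (Finset.mem_sdiff.1 (hEF he)).1 hxe⟩
  simp only [mem_filter, mem_powerset] at hT hmin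
  obtain ⟨hTE, hTne, hTc⟩ := hT
  have hgrow : ∀ j, 1 ≤ j → j ≤ T.card → ∃ A ⊆ T, A.card = j ∧ (A.sup id \ U).card ≤ j + 1 := by
    intro j hj
    induction j, hj using Nat.le_induction with
    | base =>
      intro _
      obtain ⟨e, he⟩ := hTne
      exact ⟨{e}, by simpa using he, by simp, by simpa using hE2 e (hTE he)⟩
    | succ j hj ih =>
      intro hjT
      obtain ⟨A, hAT, hAj, hAc⟩ := ih (by omega)
      have hBc : (T \ A).card + A.card = T.card := Finset.card_sdiff_add_card_eq_card hAT
      have hex : ∃ e ∈ T \ A, ∃ x ∈ e, x ∉ U ∧ x ∈ A.sup id := by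
        by_contra hno
        push Not at hno
        have hA' : A.card < (A.sup id \ U).card := by
          by_contra hc
          have := hmin A ⟨hAT.trans hTE, Finset.card_pos.1 (by omega), by omega⟩
          omega
        have hB' : (T \ A).card < ((T \ A).sup id \ U).card := by
          by_contra hc
          have := hmin (T \ A) ⟨Finset.sdiff_subset.trans hTE, Finset.card_pos.1 (by omega), by omega⟩
          omega
        have hd : Disjoint (A.sup id \ U) ((T \ A).sup id \ U) := by
          rw [Finset.disjoint_left]
          intro x hx hx'
          obtain ⟨e, he, hxe⟩ := Finset.mem_sup.1 (Finset.mem_sdiff.1 hx').1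
          exact hno e he x hxe (Finset.mem_sdiff.1 hx).2 (Finset.mem_sdiff.1 hx).1
        have hsub : (A.sup id \ U) ∪ ((T \ A).sup id \ U) ⊆ T.sup id \ U := by
          apply Finset.union_subset
          · exact Finset.sdiff_subset_sdiff (Finset.sup_mono hAT) subset_rfl
          · exact Finset.sdiff_subset_sdiff (Finset.sup_mono Finset.sdiff_subset) subset_rfl
        have := Finset.card_le_card hsub
        rw [Finset.card_union_of_disjoint hd] at this
        omega
      obtain ⟨e, he, x, hxe, hxU, hxA⟩ := hex
      rw [Finset.mem_sdiff] at he
      refine ⟨insert e A, Finset.insert_subset he.1 hAT, by rw [Finset.card_insert_of_notMem he.2, hAj], ?_⟩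
      have hsub : (insert e A).sup id \ U ⊆ (A.sup id \ U) ∪ (e \ U).erase x := by
        intro y hy
        rw [Finset.sup_insert] at hy
        simp only [id, Finset.sup_eq_union, Finset.mem_sdiff, Finset.mem_union] at hy
        simp only [Finset.mem_union, Finset.mem_sdiff, Finset.mem_erase]
        by_cases hyx : y = x
        · left; rw [hyx]; exact ⟨hxA, hxU⟩
        · rcases hy.1 with h | h
          · right; exact ⟨hyx, h, hy.2⟩
          · left; exact ⟨h, hy.2⟩
      have h' := (Finset.card_le_card hsub).trans (Finset.card_union_le _ _)
      have hx : x ∈ e \ U := Finset.mem_sdiff.2 ⟨hxe, hxU⟩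
      rw [Finset.card_erase_of_mem hx] at h'
      have := hE2 e (hTE he.1)
      omega
  by_cases hle : S.card + T.card ≤ k
  · exact hext T (hTE.trans hEF) hTne hle hTc
  · obtain ⟨A, hAT, hAj, hAc⟩ := hgrow (k - S.card) (by omega) (by omega)
    have hA := (hAT.trans hTE).trans hEF
    have hdisj : Disjoint S A := by
      rw [Finset.disjoint_left]; intro e he he'
      exact (Finset.mem_sdiff.1 (hA he')).2 he
    have hAF : S ∪ A ⊆ F := Finset.union_subset hSF (fun e he => (Finset.mem_sdiff.1 (hA he)).1)
    have hcard : (S ∪ A).card = S.card + A.card := Finset.card_union_of_disjoint hdisj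
    have hsup : ((S ∪ A).sup id).card ≤ U.card + (A.sup id \ U).card := by
      rw [Finset.sup_union, ← hU]
      have : U ⊔ A.sup id = U ∪ (A.sup id \ U) := by simp
      rw [this]; exact Finset.card_union_le _ _
    have := hfree _ hAF (by omega)
    omega

theorem g_bdd (k n : ℕ) : BddAbove { m | ∃ F : Finset (Finset (Fin n)), (∀ e ∈ F, e.card = 3) ∧
    (∀ S ⊆ F, S.card = k → k + 2 < (S.sup id).card) ∧
    (∀ ℓ, 2 ≤ ℓ → ℓ ≤ k - 1 → ∀ S ⊆ F, S.card = ℓ → ℓ + 1 < (S.sup id).card) ∧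
    F.card = m } :=
  ⟨Fintype.card (Finset (Fin n)), by rintro m ⟨F, -, -, -, rfl⟩; exact Finset.card_le_univ F⟩

theorem f_bdd (k n : ℕ) : BddAbove { m | ∃ F : Finset (Finset (Fin n)), (∀ e ∈ F, e.card = 3) ∧
    (∀ S ⊆ F, S.card = k → k + 2 < (S.sup id).card) ∧ F.card = m } :=
  ⟨Fintype.card (Finset (Fin n)), by rintro m ⟨F, -, -, rfl⟩; exact Finset.card_le_univ F⟩

theorem f_attain (k n : ℕ) (hk : 2 ≤ k) : ∃ F : Finset (Finset (Fin n)), (∀ e ∈ F, e.card = 3) ∧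
    (∀ S ⊆ F, S.card = k → k + 2 < (S.sup id).card) ∧ F.card = fBES k n := by
  have := Nat.sSup_mem (s := { m | ∃ F : Finset (Finset (Fin n)), (∀ e ∈ F, e.card = 3) ∧
    (∀ S ⊆ F, S.card = k → k + 2 < (S.sup id).card) ∧ F.card = m }) ⟨0, ∅, by simp, by
      intro S hS hc
      rw [Finset.subset_empty.1 hS] at hc
      simp at hc; omega, by simp⟩ (f_bdd k n)
  exact this

theorem g_le_f (k n : ℕ) (hk : 2 ≤ k) : gBES k n ≤ fBES k n := by
  refine csSup_le ⟨0, ∅, by simp, ?_, ?_, by simp⟩ ?_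
  · intro S hS hc
    rw [Finset.subset_empty.1 hS] at hc
    simp at hc; omega
  · intro l hl _ S hS hc
    rw [Finset.subset_empty.1 hS] at hc
    simp at hc; omega
  · rintro m ⟨F, h1, h2, -, h4⟩
    exact le_csSup (f_bdd k n) ⟨F, h1, h2, h4⟩

theorem le_g {α : Type*} [DecidableEq α] (k : ℕ) (F : Finset (Finset α)) (V : Finset α)
    (h3 : ∀ e ∈ F, e.card = 3) (hV : ∀ e ∈ F, e ⊆ V)
    (hfree : ∀ S ⊆ F, S.card = k → k + 2 < (S.sup id).card)
    (hl : ∀ ℓ, 2 ≤ ℓ → ℓ ≤ k - 1 → ∀ S ⊆ F, S.card = ℓ → ℓ + 1 < (S.sup id).card) :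
    F.card ≤ gBES k V.card := by
  let φ := V.equivFin
  let ψ : Fin V.card ↪ α := φ.symm.toEmbedding.trans (Function.Embedding.subtype _)
  have hψ : ∀ x ∈ V, ∃ i, ψ i = x := fun x hx => ⟨φ ⟨x, hx⟩, by simp [ψ]⟩
  let G : Finset (Finset (Fin V.card)) := univ.filter (fun e => e.map ψ ∈ F)
  let M : Finset (Fin V.card) ↪ Finset α := ⟨fun e => e.map ψ, Finset.map_injective ψ⟩
  have hGF : G.map M = F := by
    ext e
    simp only [Finset.mem_map, G, M, Finset.mem_filter, Finset.mem_univ, true_and,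
      Function.Embedding.coeFn_mk]
    constructor
    · rintro ⟨a, ha, rfl⟩; exact ha
    · intro he
      have : (univ.filter (fun i => ψ i ∈ e)).map ψ = e := by
        ext x
        simp only [Finset.mem_map, Finset.mem_filter, Finset.mem_univ, true_and]
        constructor
        · rintro ⟨a, ha, rfl⟩; exact ha
        · intro hx
          obtain ⟨i, rfl⟩ := hψ x (hV e he hx)
          exact ⟨i, hx, rfl⟩
      exact ⟨_, by rw [this]; exact he, this⟩
  have hsup : ∀ S : Finset (Finset (Fin V.card)), ((S.map M).sup id).card = (S.sup id).card := by
    intro S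
    have : (S.map M).sup id = (S.sup id).map ψ := by
      ext x
      simp only [Finset.mem_sup, Finset.mem_map, id, M, Function.Embedding.coeFn_mk]
      constructor
      · rintro ⟨_, ⟨a, ha, rfl⟩, hx⟩
        obtain ⟨i, hi, rfl⟩ := Finset.mem_map.1 hx
        exact ⟨i, ⟨a, ha, hi⟩, rfl⟩
      · rintro ⟨i, ⟨a, ha, hi⟩, rfl⟩
        exact ⟨_, ⟨a, ha, rfl⟩, Finset.mem_map_of_mem _ hi⟩
    rw [this, Finset.card_map]
  have hsub : ∀ S ⊆ G, S.map M ⊆ F := fun S hS => by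
    rw [← hGF]; exact Finset.map_subset_map.2 hS
  refine le_csSup (g_bdd k _) ⟨G, ?_, ?_, ?_, ?_⟩
  · intro e he
    have := h3 _ (Finset.mem_filter.1 he).2
    rwa [Finset.card_map] at this
  · intro S hS hc
    rw [← hsup]; exact hfree _ (hsub S hS) (by rw [Finset.card_map, hc])
  · intro l h2 hk S hS hc
    rw [← hsup]; exact hl l h2 hk _ (hsub S hS) (by rw [Finset.card_map, hc])
  · rw [← hGF, Finset.card_map]

theorem f_le (k n : ℕ) (hk : 2 ≤ k) : fBES k n ≤ k * n ^ 2 := by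
  obtain ⟨F, h3, hfree, hF⟩ := f_attain k n hk
  rw [← hF]
  rcases Nat.eq_zero_or_pos n with rfl | hn
  · have : F = ∅ := by
      apply Finset.eq_empty_of_forall_notMem
      intro e he
      have := h3 e he
      have := Finset.card_le_univ e
      rw [Fintype.card_fin] at this
      omega
    simp [this]
  have hch : ∀ e : Finset (Fin n), ∃ p : Fin n × Fin n, e ∈ F → p.1 ∈ e ∧ p.2 ∈ e ∧ p.1 ≠ p.2 := by
    intro e
    by_cases he : e ∈ F
    · obtain ⟨a, ha, b, hb, hab⟩ := Finset.one_lt_card.1 (show 1 < e.card by rw [h3 e he]; omega)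
      exact ⟨(a, b), fun _ => ⟨ha, hb, hab⟩⟩
    · exact ⟨(⟨0, hn⟩, ⟨0, hn⟩), fun h => absurd h he⟩
  choose p hp using hch
  have := Finset.card_le_mul_card_image (f := p) F k ?_
  · refine this.trans (Nat.mul_le_mul_left _ ((Finset.card_le_univ _).trans ?_))
    simp [sq]
  · intro q hq
    by_contra hc
    push Not at hc
    obtain ⟨S, hS, hSc⟩ := Finset.exists_subset_card_eq hc.le
    have := hfree S (hS.trans (Finset.filter_subset _ _)) hSc
    have hsub : S.sup id ⊆ {q.1, q.2} ∪ S.biUnion (fun e => e \ {q.1, q.2}) := by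
      intro x hx
      obtain ⟨e, he, hxe⟩ := Finset.mem_sup.1 hx
      by_cases hxq : x ∈ ({q.1, q.2} : Finset (Fin n))
      · exact Finset.mem_union_left _ hxq
      · exact Finset.mem_union_right _ (Finset.mem_biUnion.2 ⟨e, he, Finset.mem_sdiff.2 ⟨hxe, hxq⟩⟩)
    have h1 := (Finset.card_le_card hsub).trans (Finset.card_union_le _ _)
    have h2 : (S.biUnion (fun e => e \ {q.1, q.2})).card ≤ S.card * 1 := by
      refine Finset.card_biUnion_le_card_mul _ _ _ fun e he => ?_
      have heq := Finset.mem_filter.1 (hS he)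
      obtain ⟨a1, a2, a3⟩ := hp e heq.1
      rw [heq.2] at a1 a2 a3
      rw [Finset.card_sdiff_of_subset (by
        intro x hx; simp only [Finset.mem_insert, Finset.mem_singleton] at hx
        rcases hx with rfl | rfl <;> assumption), h3 e heq.1, Finset.card_pair a3]
    have h3 : ({q.1, q.2} : Finset (Fin n)).card ≤ 2 := Finset.card_le_two
    omega

theorem extract (k n : ℕ) (hk : 2 ≤ k) : ∃ (i : ℕ) (m : ℕ), i ≤ n ∧
    (fBES k n : ℝ) - 0.15 * n ^ 2 ≤ m - 0.15 * i ^ 2 ∧ m ≤ 2 ^ 2 ^ i ∧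
    (3 + 20 * k ≤ i → m ≤ gBES k i) := by
  obtain ⟨F, h3, hfree, hF⟩ := f_attain k n hk
  obtain ⟨V, -, hmax⟩ := Finset.exists_max_image (univ : Finset (Finset (Fin n)))
    (fun V => ((F.filter (fun e => e ⊆ V)).card : ℝ) - 0.15 * (V.card : ℝ) ^ 2) ⟨∅, by simp⟩
  refine ⟨V.card, (F.filter (fun e => e ⊆ V)).card, ?_, ?_, ?_, ?_⟩
  · simpa using Finset.card_le_univ V
  · have := hmax univ (Finset.mem_univ _)
    simpa [hF] using this
  · refine le_trans (Finset.card_le_card (t := V.powerset) ?_) (by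
      rw [Finset.card_powerset]; exact Nat.lt_two_pow_self.le)
    intro e he
    exact Finset.mem_powerset.2 (Finset.mem_filter.1 he).2
  · intro hi
    set G := F.filter (fun e => e ⊆ V) with hG
    have hGF : G ⊆ F := Finset.filter_subset _ _
    have g3 : ∀ e ∈ G, e.card = 3 := fun e he => h3 e (hGF he)
    have gV : ∀ e ∈ G, e ⊆ V := fun e he => (Finset.mem_filter.1 he).2
    have gfree : ∀ S ⊆ G, S.card = k → k + 2 < (S.sup id).card :=
      fun S hS => hfree S (hS.trans hGF)
    refine le_g k G V g3 gV gfree (core_free k G V g3 gV gfree ?_)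
    intro v hv
    have h := hmax (V.erase v) (Finset.mem_univ _)
    have hsplit : (F.filter (fun e => e ⊆ V.erase v)).card + (G.filter (fun e => v ∈ e)).card = G.card := by
      rw [← Finset.card_filter_add_card_filter_not (s := G) (fun e => v ∈ e), add_comm]
      congr 2
      ext e
      simp only [hG, Finset.mem_filter, Finset.subset_erase]
      tauto
    have hcv : (V.erase v).card + 1 = V.card := Finset.card_erase_add_one hv
    have hs : ((F.filter (fun e => e ⊆ V.erase v)).card : ℝ) + (G.filter (fun e => v ∈ e)).card = G.card := by
      exact_mod_cast hsplit
    have hc : ((V.erase v).card : ℝ) = V.card - 1 := by rw [← hcv]; push_cast; ring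
    rw [hc] at h
    have hi' : (3 : ℝ) + 20 * k ≤ V.card := by exact_mod_cast hi
    have : (V.card : ℝ) + 4 * k ≤ 4 * ((G.filter (fun e => v ∈ e)).card : ℝ) := by
      nlinarith
    exact_mod_cast this

/-- Assuming `liminf n⁻² f ≥ 1/6` and `liminf n⁻² g ≥ limsup n⁻² g`,
we have `limsup n⁻² f^(3)(n;k+2,k) = limsup n⁻² g^(3)(n;k+2,k)`. -/
theorem limsup_f_eq_limsup_g (k : ℕ) (hk : 2 ≤ k)
    (hlif : 1 / 6 ≤ liminf (fun n : ℕ => (fBES k n : ℝ) / (n : ℝ) ^ 2) atTop)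
    (hlig : limsup (fun n : ℕ => (gBES k n : ℝ) / (n : ℝ) ^ 2) atTop ≤
      liminf (fun n : ℕ => (gBES k n : ℝ) / (n : ℝ) ^ 2) atTop) :
    limsup (fun n : ℕ => (fBES k n : ℝ) / (n : ℝ) ^ 2) atTop =
      limsup (fun n : ℕ => (gBES k n : ℝ) / (n : ℝ) ^ 2) atTop := by
  have hbd : ∀ n : ℕ, (fBES k n : ℝ) / (n : ℝ) ^ 2 ≤ k := by
    intro n
    refine div_le_of_le_mul₀ (by positivity) (by positivity) ?_
    exact_mod_cast f_le k n hk
  have hgf : ∀ n : ℕ, (gBES k n : ℝ) / (n : ℝ) ^ 2 ≤ (fBES k n : ℝ) / (n : ℝ) ^ 2 := by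
    intro n
    have : (gBES k n : ℝ) ≤ fBES k n := by exact_mod_cast g_le_f k n hk
    gcongr
  have hfb : IsBoundedUnder (· ≤ ·) atTop (fun n : ℕ => (fBES k n : ℝ) / (n : ℝ) ^ 2) :=
    isBoundedUnder_of ⟨k, hbd⟩
  have hgb : IsBoundedUnder (· ≤ ·) atTop (fun n : ℕ => (gBES k n : ℝ) / (n : ℝ) ^ 2) :=
    isBoundedUnder_of ⟨k, fun n => (hgf n).trans (hbd n)⟩
  have hfb' : IsBoundedUnder (· ≥ ·) atTop (fun n : ℕ => (fBES k n : ℝ) / (n : ℝ) ^ 2) :=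
    isBoundedUnder_of ⟨0, fun n => by positivity⟩
  have hgb' : IsBoundedUnder (· ≥ ·) atTop (fun n : ℕ => (gBES k n : ℝ) / (n : ℝ) ^ 2) :=
    isBoundedUnder_of ⟨0, fun n => by positivity⟩
  apply le_antisymm
  · by_contra hlt
    push Not at hlt
    have hc : (1 : ℝ) / 6 ≤ limsup (fun n : ℕ => (fBES k n : ℝ) / (n : ℝ) ^ 2) atTop :=
      hlif.trans (liminf_le_limsup hfb hfb')
    obtain ⟨d, hd1, hd2⟩ := exists_between (max_lt hlt (lt_of_lt_of_le (by norm_num : (0.15 : ℝ) < 1 / 6) hc))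
    obtain ⟨hdL, hd15⟩ := max_lt_iff.1 hd1
    have hev := eventually_lt_of_limsup_lt hdL hgb
    have hfr := frequently_lt_of_lt_limsup hfb'.isCoboundedUnder_le hd2
    obtain ⟨N, hN⟩ := eventually_atTop.1 hev
    set N' := max N (3 + 20 * k) with hN'
    obtain ⟨M, hM⟩ := exists_nat_gt (((2 ^ 2 ^ N' : ℕ) : ℝ) / (d - 0.15))
    obtain ⟨n, hn, hnf⟩ := frequently_atTop.1 hfr (M + 1)
    obtain ⟨i, m, hin, hm, hmb, hmg⟩ := extract k n hk
    have hn1 : (M : ℝ) + 1 ≤ n := by exact_mod_cast hn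
    have hM0 : (0 : ℝ) ≤ M := by positivity
    have hnpos : (0 : ℝ) < n := by linarith
    rw [lt_div_iff₀ (by positivity)] at hnf
    have hin' : (i : ℝ) ≤ n := by exact_mod_cast hin
    have hi0 : (0 : ℝ) ≤ i := by positivity
    have hsq : (i : ℝ) ^ 2 ≤ (n : ℝ) ^ 2 := by gcongr
    by_cases hi : N' ≤ i
    · have h1 := hmg ((le_max_right _ _).trans hi)
      have h2 := hN i ((le_max_left _ _).trans hi)
      have hipos : (0 : ℝ) < i := by
        have : 0 < i := by have := (le_max_right N (3 + 20 * k)).trans hi; omega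
        exact_mod_cast this
      rw [div_lt_iff₀ (by positivity)] at h2
      have h1' : (m : ℝ) ≤ gBES k i := by exact_mod_cast h1
      nlinarith
    · have h3 : (m : ℝ) ≤ ((2 ^ 2 ^ N' : ℕ) : ℝ) := by
        have : m ≤ 2 ^ 2 ^ N' := hmb.trans
          (Nat.pow_le_pow_right (by norm_num) (Nat.pow_le_pow_right (by norm_num) (by omega)))
        exact_mod_cast this
      rw [div_lt_iff₀ (by linarith)] at hM
      have h4 : (d - 0.15) * (n : ℝ) ^ 2 ≤ m := by nlinarith [sq_nonneg (i : ℝ)]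
      have h5 : (M : ℝ) ≤ (n : ℝ) ^ 2 := by nlinarith
      have h6 : (M : ℝ) * (d - 0.15) ≤ (n : ℝ) ^ 2 * (d - 0.15) :=
        mul_le_mul_of_nonneg_right h5 (by linarith)
      linarith
  · exact limsup_le_limsup (Eventually.of_forall hgf) hgb'.isCoboundedUnder_le hfb
end
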